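/- Let m, n be nonnegative integers and ω a real number. The function x ↦ (−1)^{m+n}·(Φ^{(m+n+1)}(x) + ω·Φ^{(m)}(x)·Φ^{(n)}(x)) is completely monotonic on (0,∞) if and only if ω ≥ 2(m+n+1)!/(m!·n!). -/

import Mathlib

/-- A function `f` is completely monotonic on a set `s` if it has derivatives of all
orders on `s` and `(-1)^n f^(n) ≥ 0` on `s` for every `n ≥ 0`. -/
def CompletelyMonotonicOn (f : ℝ → ℝ) (s : Set ℝ) : Prop :=
  (∀ n : ℕ, ∀ x ∈ s, DifferentiableAt ℝ (iteratedDeriv n f) x) ∧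
  ∀ n : ℕ, ∀ x ∈ s, 0 ≤ (-1:ℝ) ^ n * iteratedDeriv n f x

/-- `Φ x = x * ψ'(x) - 1`, where `ψ'` is the trigamma function, i.e. the second
derivative of the logarithm of the gamma function. -/
noncomputable def Phi (x : ℝ) : ℝ :=
  x * iteratedDeriv 2 (fun y => Real.log (Real.Gamma y)) x - 1

theorem nonneg_of_hasDerivAt_of_nonneg {f f' : ℝ → ℝ} (hf : ∀ x, HasDerivAt f (f' x) x)
    (h0 : f 0 = 0) (hf' : ∀ x, 0 ≤ x → 0 ≤ f' x) {x : ℝ} (hx : 0 ≤ x) : 0 ≤ f x := by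
  have hmono : MonotoneOn f (Set.Ici 0) := by
    refine monotoneOn_of_deriv_nonneg (convex_Ici 0)
      (fun y _ => (hf y).continuousAt.continuousWithinAt)
      (fun y _ => (hf y).differentiableAt.differentiableWithinAt) fun y hy => ?_
    rw [interior_Ici] at hy
    rw [(hf y).deriv]
    exact hf' y (le_of_lt hy)
  simpa [h0] using hmono Set.self_mem_Ici hx hx

section HyperbolicInequalities

open Real

theorem sinh_le_self_mul_cosh {t : ℝ} (ht : 0 ≤ t) : sinh t ≤ t * cosh t := by
  have := nonneg_of_hasDerivAt_of_nonneg (f := fun t => t * cosh t - sinh t)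
    (f' := fun t => t * sinh t)
    (fun x => (((hasDerivAt_id' x).mul (hasDerivAt_cosh x)).sub (hasDerivAt_sinh x)).congr_deriv
      (by ring)) (by simp) (fun x hx => mul_nonneg hx (sinh_nonneg_iff.2 hx)) ht
  linarith

theorem one_add_sq_div_two_le_cosh {t : ℝ} (ht : 0 ≤ t) : 1 + t ^ 2 / 2 ≤ cosh t := by
  have := nonneg_of_hasDerivAt_of_nonneg (f := fun t => cosh t - (1 + t ^ 2 / 2))
    (f' := fun t => sinh t - t)
    (fun x => ((hasDerivAt_cosh x).sub
      ((((hasDerivAt_id' x).pow 2).div_const 2).const_add 1)).congr_deriv (by simp))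
    (by simp) (fun x hx => sub_nonneg.2 (self_le_sinh_iff.2 hx)) ht
  linarith

theorem sq_mul_sinh_le {t : ℝ} (ht : 0 ≤ t) :
    t ^ 2 * sinh t ≤ (sinh t + t) * (cosh t - 1) := by
  have hid : ∀ x : ℝ, HasDerivAt (fun x : ℝ => x) 1 x := hasDerivAt_id'
  have hs := hasDerivAt_sinh
  have hc := hasDerivAt_cosh
  have h4 : ∀ x : ℝ, 0 ≤ x →
      0 ≤ 16 * (sinh x * cosh x) - 9 * sinh x - 7 * (x * cosh x) - x ^ 2 * sinh x := by
    intro x hx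
    have h1 : x ≤ sinh x := self_le_sinh_iff.2 hx
    nlinarith [mul_nonneg (sub_nonneg.2 h1) (by linarith [one_le_cosh x] : 0 ≤ cosh x),
      mul_nonneg (hx.trans h1) (sub_nonneg.2 (one_add_sq_div_two_le_cosh hx)),
      mul_nonneg (hx.trans h1) (sq_nonneg x)]
  have h3 : ∀ x : ℝ, 0 ≤ x →
      0 ≤ 8 * sinh x ^ 2 + 4 - 4 * cosh x - 5 * (x * sinh x) - x ^ 2 * cosh x := by
    intro x hx
    refine nonneg_of_hasDerivAt_of_nonneg
      (f := fun x => 8 * sinh x ^ 2 + 4 - 4 * cosh x - 5 * (x * sinh x) - x ^ 2 * cosh x)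
      (fun y => HasDerivAt.congr_deriv
        ((((((hs y).pow 2).const_mul 8).add_const 4).sub ((hc y).const_mul 4)).sub
          (((hid y).mul (hs y)).const_mul 5) |>.sub (((hid y).pow 2).mul (hc y))) ?_)
      (by simp) h4 hx
    simp; ring
  have h2 : ∀ x : ℝ, 0 ≤ x →
      0 ≤ 4 * (sinh x * cosh x) - sinh x - 3 * (x * cosh x) - x ^ 2 * sinh x := by
    intro x hx
    refine nonneg_of_hasDerivAt_of_nonneg
      (f := fun x => 4 * (sinh x * cosh x) - sinh x - 3 * (x * cosh x) - x ^ 2 * sinh x)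
      (fun y => HasDerivAt.congr_deriv
        (((((hs y).mul (hc y)).const_mul 4).sub (hs y)).sub
          (((hid y).mul (hc y)).const_mul 3) |>.sub (((hid y).pow 2).mul (hs y))) ?_)
      (by simp) h3 hx
    simp
    linear_combination 4 * cosh_sq y
  have h1 : ∀ x : ℝ, 0 ≤ x → 0 ≤ 2 * sinh x ^ 2 - x * sinh x - x ^ 2 * cosh x := by
    intro x hx
    refine nonneg_of_hasDerivAt_of_nonneg
      (f := fun x => 2 * sinh x ^ 2 - x * sinh x - x ^ 2 * cosh x)
      (fun y => HasDerivAt.congr_deriv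
        (((((hs y).pow 2).const_mul 2).sub ((hid y).mul (hs y))).sub
          (((hid y).pow 2).mul (hc y))) ?_) (by simp) h2 hx
    simp; ring
  have h0 := nonneg_of_hasDerivAt_of_nonneg
    (f := fun x => (sinh x + x) * (cosh x - 1) - x ^ 2 * sinh x)
    (fun y => (((hs y).add (hid y)).mul ((hc y).sub_const 1)).sub
        (((hid y).pow 2).mul (hs y))) (by simp) (fun x hx => by
      have := h1 x hx
      simp
      linarith [cosh_sq x]) ht
  linarith

/-- The odd function `(sinh t - t) / (cosh t - 1)`, which increases from `0` to `1` on
`[0, ∞)`. -/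
noncomputable def sinhRatio (t : ℝ) : ℝ := (sinh t - t) / (cosh t - 1)

theorem cosh_sub_one_pos {t : ℝ} (ht : 0 < t) : 0 < cosh t - 1 :=
  sub_pos.2 (one_lt_cosh.2 ht.ne')

theorem sinhRatio_nonneg {t : ℝ} (ht : 0 < t) : 0 ≤ sinhRatio t :=
  div_nonneg (sub_nonneg.2 (self_le_sinh_iff.2 ht.le)) (cosh_sub_one_pos ht).le

theorem sinhRatio_le_one {t : ℝ} (ht : 0 < t) : sinhRatio t ≤ 1 := by
  rw [sinhRatio, div_le_one (cosh_sub_one_pos ht)]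
  have h1 := cosh_sub_sinh t
  have h2 := add_one_le_exp (-t)
  linarith

theorem sinhRatio_le_self {t : ℝ} (ht : 0 < t) : sinhRatio t ≤ t := by
  rw [sinhRatio, div_le_iff₀ (cosh_sub_one_pos ht)]
  linarith [sinh_le_self_mul_cosh ht.le]

theorem sinhRatio_div_antitoneOn : AntitoneOn (fun t => sinhRatio t / t) (Set.Ioi 0) := by
  have hd : ∀ t : ℝ, 0 < t → HasDerivAt (fun t => sinhRatio t / t)
      ((((cosh t - 1) * (cosh t - 1) - (sinh t - t) * sinh t) / (cosh t - 1) ^ 2 * t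
        - sinhRatio t * 1) / t ^ 2) t := fun t ht =>
    ((((hasDerivAt_sinh t).sub (hasDerivAt_id' t)).div ((hasDerivAt_cosh t).sub_const 1)
      (cosh_sub_one_pos ht).ne').div (hasDerivAt_id' t) ht.ne')
  refine antitoneOn_of_deriv_nonpos (convex_Ioi 0)
    (fun t ht => (hd t ht).continuousAt.continuousWithinAt)
    (fun t ht => (hd t (interior_subset ht)).differentiableAt.differentiableWithinAt)
    fun t ht => ?_
  have ht : 0 < t := interior_subset ht
  have hc := cosh_sub_one_pos ht
  rw [(hd t ht).deriv]
  refine div_nonpos_of_nonpos_of_nonneg ?_ (sq_nonneg t)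
  have : ((cosh t - 1) * (cosh t - 1) - (sinh t - t) * sinh t) / (cosh t - 1) ^ 2 * t
      - sinhRatio t * 1 =
      (t ^ 2 * sinh t - (sinh t + t) * (cosh t - 1)) / (cosh t - 1) ^ 2 := by
    rw [sinhRatio]
    field_simp
    linear_combination t * cosh_sq t
  rw [this]
  exact div_nonpos_of_nonpos_of_nonneg (by linarith [sq_mul_sinh_le ht.le]) (sq_nonneg _)

theorem sinhRatio_add_le {s t : ℝ} (hs : 0 < s) (ht : 0 < t) :
    sinhRatio (s + t) ≤ sinhRatio s + sinhRatio t := by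
  have hst : 0 < s + t := add_pos hs ht
  have h1 : sinhRatio (s + t) / (s + t) ≤ sinhRatio s / s :=
    sinhRatio_div_antitoneOn hs hst (by linarith)
  have h2 : sinhRatio (s + t) / (s + t) ≤ sinhRatio t / t :=
    sinhRatio_div_antitoneOn ht hst (by linarith)
  rw [le_div_iff₀ hs] at h1
  rw [le_div_iff₀ ht] at h2
  calc sinhRatio (s + t) = sinhRatio (s + t) / (s + t) * s + sinhRatio (s + t) / (s + t) * t := by
        field_simp
    _ ≤ _ := add_le_add h1 h2

/-- The density whose Laplace transform is `Phi`, i.e. the derivative of `t / (1 - exp (-t))`. -/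
noncomputable def phiKernel (t : ℝ) : ℝ := (1 + sinhRatio t) / 2

theorem half_le_phiKernel {t : ℝ} (ht : 0 < t) : 1 / 2 ≤ phiKernel t := by
  have := sinhRatio_nonneg ht
  rw [phiKernel]; linarith

theorem phiKernel_le_one {t : ℝ} (ht : 0 < t) : phiKernel t ≤ 1 := by
  have := sinhRatio_le_one ht
  rw [phiKernel]; linarith

theorem phiKernel_le {t : ℝ} (ht : 0 < t) : phiKernel t ≤ (1 + t) / 2 := by
  have := sinhRatio_le_self ht
  rw [phiKernel]; linarith

theorem phiKernel_nonneg {t : ℝ} (ht : 0 < t) : 0 ≤ phiKernel t :=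
  (by norm_num : (0 : ℝ) ≤ 1 / 2).trans (half_le_phiKernel ht)

theorem phiKernel_add_le {s t : ℝ} (hs : 0 < s) (ht : 0 < t) :
    phiKernel (s + t) ≤ 2 * (phiKernel s * phiKernel t) := by
  have h1 := sinhRatio_add_le hs ht
  have h2 := mul_nonneg (sinhRatio_nonneg hs) (sinhRatio_nonneg ht)
  simp only [phiKernel]
  linarith

theorem measurable_phiKernel : Measurable phiKernel := by
  unfold phiKernel sinhRatio
  fun_prop

theorem one_sub_exp_neg_pos {t : ℝ} (ht : 0 < t) : 0 < 1 - exp (-t) :=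
  sub_pos.2 (exp_lt_one_iff.2 (neg_lt_zero.2 ht))

theorem hasDerivAt_div_one_sub_exp_neg {t : ℝ} (ht : 0 < t) :
    HasDerivAt (fun t => t / (1 - exp (-t))) (phiKernel t) t := by
  have h := one_sub_exp_neg_pos ht
  refine ((hasDerivAt_id' t).div ((hasDerivAt_neg t).exp.const_sub 1) h.ne').congr_deriv ?_
  have he : exp t = (exp (-t))⁻¹ := by rw [exp_neg, inv_inv]
  have hb := exp_pos (-t)
  have h1 : cosh t - 1 = (1 - exp (-t)) ^ 2 / (2 * exp (-t)) := by
    rw [cosh_eq, he]; field_simp; ring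
  have h2 : sinh t = (1 - exp (-t) ^ 2) / (2 * exp (-t)) := by
    rw [sinh_eq, he]; field_simp
  rw [phiKernel, sinhRatio, h1, h2]
  field_simp
  ring

theorem div_one_sub_exp_neg_mem_Icc {t : ℝ} (ht : 0 < t) :
    t / (1 - exp (-t)) ∈ Set.Icc 1 (1 + t) := by
  have h := one_sub_exp_neg_pos ht
  rw [Set.mem_Icc, one_le_div h, div_le_iff₀ h]
  constructor
  · linarith [add_one_le_exp (-t)]
  · have h1 : exp (-t) * exp t = 1 := by rw [← exp_add]; simp
    nlinarith [mul_le_mul_of_nonneg_left (add_one_le_exp t) (exp_pos (-t)).le]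

end HyperbolicInequalities

section LaplaceMoments

open Real MeasureTheory Set

theorem integral_pow_mul_sub_pow (s : ℝ) (a b : ℕ) :
    ∫ t in (0 : ℝ)..s, t ^ a * (s - t) ^ b =
      (a.factorial * b.factorial : ℝ) / (a + b + 1).factorial * s ^ (a + b + 1) := by
  induction b generalizing a with
  | zero =>
    simp only [pow_zero, mul_one, integral_pow, Nat.factorial_zero, add_zero,
      Nat.factorial_succ, Nat.cast_one]
    push_cast
    field_simp
    simp
  | succ b ih =>
    have hd : ∀ t ∈ uIcc 0 s, HasDerivAt (fun t => t ^ (a + 1) * (s - t) ^ (b + 1))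
        ((a + 1) * (t ^ a * (s - t) ^ (b + 1)) - (b + 1) * (t ^ (a + 1) * (s - t) ^ b)) t := by
      intro t _
      refine (((hasDerivAt_id' t).pow (a + 1)).mul
        (((hasDerivAt_id' t).const_sub s).pow (b + 1))).congr_deriv ?_
      simp
      ring
    have h := intervalIntegral.integral_eq_sub_of_hasDerivAt hd
      (Continuous.intervalIntegrable (by fun_prop) _ _)
    rw [intervalIntegral.integral_sub (Continuous.intervalIntegrable (by fun_prop) _ _)
      (Continuous.intervalIntegrable (by fun_prop) _ _), intervalIntegral.integral_const_mul,
      intervalIntegral.integral_const_mul, ih (a + 1)] at h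
    have he : a + 1 + b + 1 = a + (b + 1) + 1 := by ring
    rw [he] at h
    have ha : (a + 1 : ℝ) ≠ 0 := by positivity
    apply mul_left_cancel₀ ha
    simp only [Nat.factorial_succ a, Nat.factorial_succ b] at h ⊢
    simp only [sub_self, zero_pow (Nat.succ_ne_zero _), mul_zero, zero_mul] at h
    push_cast at h ⊢
    linear_combination h

theorem integrableOn_pow_mul_exp_neg {x : ℝ} (hx : 0 < x) (k : ℕ) :
    IntegrableOn (fun t : ℝ => t ^ k * exp (-(x * t))) (Ioi 0) := by
  have := integrableOn_rpow_mul_exp_neg_mul_rpow (p := 1) (s := k) (b := x)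
    (by linarith [(Nat.cast_nonneg k : (0 : ℝ) ≤ k)]) one_pos hx
  simpa using this

theorem integral_pow_mul_exp_neg {x : ℝ} (hx : 0 < x) (k : ℕ) :
    ∫ t in Ioi (0 : ℝ), t ^ k * exp (-(x * t)) = k.factorial / x ^ (k + 1) := by
  have := integral_rpow_mul_exp_neg_mul_Ioi (a := k + 1) (r := x) (by positivity) hx
  rw [Gamma_nat_eq_factorial] at this
  simp only [add_sub_cancel_right, rpow_natCast] at this
  rw [this, ← Nat.cast_succ, rpow_natCast, one_div, inv_pow, Nat.succ_eq_add_one]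
  ring

/-- The `k`-th moment of the Laplace transform of `phiKernel`. -/
noncomputable def laplaceMoment (k : ℕ) (x : ℝ) : ℝ :=
  ∫ t in Ioi (0 : ℝ), phiKernel t * (t ^ k * exp (-(x * t)))

theorem measurable_phiKernel_mul (k : ℕ) (x : ℝ) :
    Measurable fun t : ℝ => phiKernel t * (t ^ k * exp (-(x * t))) :=
  measurable_phiKernel.mul (by fun_prop)

theorem integrableOn_phiKernel_mul {x : ℝ} (hx : 0 < x) (k : ℕ) :
    IntegrableOn (fun t : ℝ => phiKernel t * (t ^ k * exp (-(x * t)))) (Ioi 0) := by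
  refine Integrable.mono' (integrableOn_pow_mul_exp_neg hx k)
    (measurable_phiKernel_mul k x).aestronglyMeasurable ?_
  filter_upwards [ae_restrict_mem measurableSet_Ioi] with t ht
  have ht : 0 < t := ht
  have h0 : 0 ≤ t ^ k * exp (-(x * t)) := by positivity
  rw [norm_of_nonneg (mul_nonneg (phiKernel_nonneg ht) h0)]
  exact mul_le_of_le_one_left h0 (phiKernel_le_one ht)

theorem le_laplaceMoment {x : ℝ} (hx : 0 < x) (k : ℕ) :
    k.factorial / (2 * x ^ (k + 1)) ≤ laplaceMoment k x := by
  have h : k.factorial / (2 * x ^ (k + 1)) =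
      ∫ t in Ioi (0 : ℝ), 1 / 2 * (t ^ k * exp (-(x * t))) := by
    rw [integral_const_mul, integral_pow_mul_exp_neg hx]
    field_simp
  rw [h]
  refine setIntegral_mono_on ((integrableOn_pow_mul_exp_neg hx k).const_mul _)
    (integrableOn_phiKernel_mul hx k) measurableSet_Ioi fun t ht => ?_
  have ht : 0 < t := ht
  exact mul_le_mul_of_nonneg_right (half_le_phiKernel ht) (by positivity)

theorem laplaceMoment_pos {x : ℝ} (hx : 0 < x) (k : ℕ) : 0 < laplaceMoment k x :=
  lt_of_lt_of_le (by positivity) (le_laplaceMoment hx k)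

theorem laplaceMoment_le {x : ℝ} (hx : 0 < x) (k : ℕ) :
    laplaceMoment k x ≤ k.factorial / (2 * x ^ (k + 1)) * (1 + (k + 1) / x) := by
  have h : k.factorial / (2 * x ^ (k + 1)) * (1 + (k + 1) / x) =
      ∫ t in Ioi (0 : ℝ), (1 / 2 * (t ^ k * exp (-(x * t))) +
        1 / 2 * (t ^ (k + 1) * exp (-(x * t)))) := by
    rw [integral_add ((integrableOn_pow_mul_exp_neg hx k).const_mul _)
      ((integrableOn_pow_mul_exp_neg hx _).const_mul _), integral_const_mul,
      integral_const_mul, integral_pow_mul_exp_neg hx, integral_pow_mul_exp_neg hx,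
      Nat.factorial_succ]
    push_cast
    field_simp
    ring
  rw [h]
  refine setIntegral_mono_on (integrableOn_phiKernel_mul hx k)
    (((integrableOn_pow_mul_exp_neg hx k).const_mul _).add
      ((integrableOn_pow_mul_exp_neg hx _).const_mul _)) measurableSet_Ioi fun t ht => ?_
  have ht : 0 < t := ht
  calc phiKernel t * (t ^ k * exp (-(x * t)))
      ≤ (1 + t) / 2 * (t ^ k * exp (-(x * t))) :=
        mul_le_mul_of_nonneg_right (phiKernel_le ht) (by positivity)
    _ = _ := by ring

theorem laplaceMoment_zero_le {x : ℝ} (hx : 0 < x) : laplaceMoment 0 x ≤ 1 / x := by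
  have h := integral_pow_mul_exp_neg hx 0
  simp only [zero_add, pow_one, Nat.factorial_zero, Nat.cast_one] at h
  rw [← h]
  refine setIntegral_mono_on (integrableOn_phiKernel_mul hx 0)
    (integrableOn_pow_mul_exp_neg hx 0) measurableSet_Ioi fun t ht => ?_
  exact mul_le_of_le_one_left (by positivity) (phiKernel_le_one ht)

theorem hasDerivAt_laplaceMoment {x : ℝ} (hx : 0 < x) (k : ℕ) :
    HasDerivAt (laplaceMoment k) (-laplaceMoment (k + 1) x) x := by
  have hx2 : 0 < x / 2 := half_pos hx
  have := (hasDerivAt_integral_of_dominated_loc_of_deriv_le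
    (F := fun x t => phiKernel t * (t ^ k * exp (-(x * t))))
    (F' := fun x t => -(phiKernel t * (t ^ (k + 1) * exp (-(x * t)))))
    (bound := fun t => t ^ (k + 1) * exp (-(x / 2 * t)))
    (μ := volume.restrict (Ioi 0)) (x₀ := x) (s := Ioi (x / 2))
    (Ioi_mem_nhds (half_lt_self hx))
    (Filter.Eventually.of_forall fun y => (measurable_phiKernel_mul k y).aestronglyMeasurable)
    (integrableOn_phiKernel_mul hx k)
    (measurable_phiKernel_mul (k + 1) x).neg.aestronglyMeasurable
    (by
      filter_upwards [ae_restrict_mem measurableSet_Ioi] with t ht y hy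
      have ht : 0 < t := ht
      have hy : x / 2 < y := hy
      have h0 : 0 ≤ t ^ (k + 1) * exp (-(y * t)) := by positivity
      rw [norm_neg, norm_of_nonneg (mul_nonneg (phiKernel_nonneg ht) h0)]
      refine (mul_le_of_le_one_left h0 (phiKernel_le_one ht)).trans ?_
      gcongr)
    (integrableOn_pow_mul_exp_neg hx2 (k + 1))
    (by
      filter_upwards with t y _
      refine (((((hasDerivAt_id' y).mul_const t).neg).exp.const_mul (t ^ k)).const_mul
        (phiKernel t)).congr_deriv ?_
      simp only [Pi.neg_apply]
      ring)).2
  rw [integral_neg] at this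
  exact this

theorem laplaceMoment_add_add_one_le {x : ℝ} (hx : 0 < x) (a b : ℕ) :
    laplaceMoment (a + b + 1) x ≤
      2 * (a + b + 1).factorial / (a.factorial * b.factorial) *
        (laplaceMoment a x * laplaceMoment b x) := by
  let f : ℕ → ℝ → ℝ := fun k t => phiKernel t * (t ^ k * exp (-(x * t)))
  have hf : ∀ k, IntegrableOn (f k) (Ioi 0) := integrableOn_phiKernel_mul hx
  have hconv := integral_posConvolution (hf a) (hf b) (ContinuousLinearMap.mul ℝ ℝ)
  have hint : IntegrableOn (fun s => ∫ t in (0 : ℝ)..s, f a t * f b (s - t)) (Ioi 0) := by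
    have := integrable_posConvolution (hf a) (hf b) (ContinuousLinearMap.mul ℝ ℝ)
    rw [posConvolution, integrable_indicator_iff measurableSet_Ioi] at this
    simpa using this
  simp only [ContinuousLinearMap.mul_apply'] at hconv
  have hle : (a.factorial * b.factorial : ℝ) / (2 * (a + b + 1).factorial) *
      laplaceMoment (a + b + 1) x ≤ laplaceMoment a x * laplaceMoment b x := by
    change _ ≤ (∫ t in Ioi 0, f a t) * ∫ t in Ioi 0, f b t
    rw [← hconv, laplaceMoment, ← integral_const_mul]
    refine setIntegral_mono_on ((hf _).const_mul _) hint measurableSet_Ioi fun s hs => ?_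
    have hs : 0 < s := hs
    have hpt : ∀ t ∈ Ioo 0 s, f a t * f b (s - t) = phiKernel t * phiKernel (s - t) *
        (exp (-(x * s)) * (t ^ a * (s - t) ^ b)) := by
      intro t _
      have : exp (-(x * s)) = exp (-(x * t)) * exp (-(x * (s - t))) := by
        rw [← exp_add]; ring_nf
      simp only [f, this]
      ring
    have hnn : ∀ t ∈ Ioo 0 s, 0 ≤ exp (-(x * s)) * (t ^ a * (s - t) ^ b) := by
      intro t ht
      have h1 : 0 < t := ht.1
      have h2 : 0 < s - t := sub_pos.2 ht.2
      positivity
    have hi : IntervalIntegrable (fun t => f a t * f b (s - t)) volume 0 s := by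
      rw [intervalIntegrable_iff_integrableOn_Ioo_of_le hs.le]
      have hcont : IntegrableOn (fun t => exp (-(x * s)) * (t ^ a * (s - t) ^ b)) (Ioo 0 s) := by
        rw [← intervalIntegrable_iff_integrableOn_Ioo_of_le hs.le]
        exact Continuous.intervalIntegrable (by fun_prop) _ _
      refine Integrable.mono' hcont ((measurable_phiKernel_mul a x).mul
        ((measurable_phiKernel_mul b x).comp (measurable_const.sub measurable_id))
        ).aestronglyMeasurable ?_
      filter_upwards [ae_restrict_mem measurableSet_Ioo] with t ht
      have h2 : 0 < s - t := sub_pos.2 ht.2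
      have h3 := mul_nonneg (phiKernel_nonneg ht.1) (phiKernel_nonneg h2)
      rw [hpt t ht, norm_of_nonneg (mul_nonneg h3 (hnn t ht))]
      exact mul_le_of_le_one_left (hnn t ht)
        (mul_le_one₀ (phiKernel_le_one ht.1) (phiKernel_nonneg h2) (phiKernel_le_one h2))
    calc (a.factorial * b.factorial : ℝ) / (2 * (a + b + 1).factorial) *
          (phiKernel s * (s ^ (a + b + 1) * exp (-(x * s))))
        = phiKernel s / 2 * exp (-(x * s)) * ∫ t in (0 : ℝ)..s, t ^ a * (s - t) ^ b := by
          rw [integral_pow_mul_sub_pow]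
          field_simp
      _ = ∫ t in (0 : ℝ)..s, phiKernel s / 2 * exp (-(x * s)) * (t ^ a * (s - t) ^ b) := by
          rw [intervalIntegral.integral_const_mul]
      _ ≤ ∫ t in (0 : ℝ)..s, f a t * f b (s - t) := by
          refine intervalIntegral.integral_mono_on_of_le_Ioo hs.le
            (Continuous.intervalIntegrable (by fun_prop) _ _) hi fun t ht => ?_
          have h := phiKernel_add_le ht.1 (sub_pos.2 ht.2)
          rw [add_sub_cancel] at h
          rw [hpt t ht, mul_assoc]
          exact mul_le_mul_of_nonneg_right (by linarith) (hnn t ht)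
  have hpos : (0 : ℝ) < (a.factorial * b.factorial : ℝ) / (2 * (a + b + 1).factorial) := by
    positivity
  rw [mul_comm, ← le_div_iff₀ hpos] at hle
  refine hle.trans_eq ?_
  field_simp

theorem integrableOn_div_one_sub_exp_neg_mul {x : ℝ} (hx : 0 < x) :
    IntegrableOn (fun t => t / (1 - exp (-t)) * exp (-(x * t))) (Ioi 0) := by
  refine Integrable.mono' ((integrableOn_pow_mul_exp_neg hx 0).add
    (integrableOn_pow_mul_exp_neg hx 1)) (by fun_prop) ?_
  filter_upwards [ae_restrict_mem measurableSet_Ioi] with t ht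
  have h := div_one_sub_exp_neg_mem_Icc ht
  rw [norm_of_nonneg (mul_nonneg (zero_le_one.trans h.1) (exp_pos _).le)]
  refine (mul_le_mul_of_nonneg_right h.2 (exp_pos _).le).trans_eq ?_
  simp; ring

theorem tendsto_pow_mul_exp_neg {x : ℝ} (hx : 0 < x) (k : ℕ) :
    Filter.Tendsto (fun t : ℝ => t ^ k * exp (-(x * t))) Filter.atTop (nhds 0) := by
  have := tendsto_rpow_mul_exp_neg_mul_atTop_nhds_zero k x hx
  simpa using this

theorem integral_div_one_sub_exp_neg_mul {x : ℝ} (hx : 0 < x) :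
    ∫ t in Ioi (0 : ℝ), t / (1 - exp (-t)) * exp (-(x * t)) = (1 + laplaceMoment 0 x) / x := by
  let F : ℝ → ℝ := fun t => if t = 0 then 1 else t / (1 - exp (-t)) * exp (-(x * t))
  have hbd : ∀ t ∈ Ioi (0 : ℝ), exp (-(x * t)) ≤ F t ∧ F t ≤ (1 + t) * exp (-(x * t)) := by
    intro t ht
    have h := div_one_sub_exp_neg_mem_Icc ht
    have hF : F t = t / (1 - exp (-t)) * exp (-(x * t)) := if_neg (ne_of_gt ht)
    rw [hF]
    exact ⟨le_mul_of_one_le_left (exp_pos _).le h.1,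
      mul_le_mul_of_nonneg_right h.2 (exp_pos _).le⟩
  have hderiv : ∀ t ∈ Ioi (0 : ℝ), HasDerivAt F (phiKernel t * (t ^ 0 * exp (-(x * t))) -
      x * (t / (1 - exp (-t)) * exp (-(x * t)))) t := by
    intro t ht
    have h := (hasDerivAt_div_one_sub_exp_neg ht).mul (((hasDerivAt_id' t).const_mul x).neg.exp)
    refine (h.congr_of_eventuallyEq ?_).congr_deriv (by simp; ring)
    filter_upwards [Ioi_mem_nhds ht] with y hy
    exact if_neg (ne_of_gt hy)
  have hF0 : F 0 = 1 := if_pos rfl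
  have hcont : ContinuousWithinAt F (Ici 0) 0 := by
    rw [← Ioi_insert, continuousWithinAt_insert_self, ContinuousWithinAt, hF0]
    refine tendsto_of_tendsto_of_tendsto_of_le_of_le'
      (g := fun t => exp (-(x * t))) (h := fun t => (1 + t) * exp (-(x * t))) ?_ ?_ ?_ ?_
    · refine (Continuous.tendsto' (by fun_prop) 0 1 (by simp)).mono_left nhdsWithin_le_nhds
    · refine (Continuous.tendsto' (by fun_prop) 0 1 (by simp)).mono_left nhdsWithin_le_nhds
    · filter_upwards [self_mem_nhdsWithin] with t ht using (hbd t ht).1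
    · filter_upwards [self_mem_nhdsWithin] with t ht using (hbd t ht).2
  have hlim : Filter.Tendsto F Filter.atTop (nhds 0) := by
    have h2 := (tendsto_pow_mul_exp_neg hx 0).add (tendsto_pow_mul_exp_neg hx 1)
    rw [add_zero] at h2
    refine tendsto_of_tendsto_of_tendsto_of_le_of_le' tendsto_const_nhds h2 ?_ ?_
    · filter_upwards [Filter.Ioi_mem_atTop 0] with t ht using (exp_pos _).le.trans (hbd t ht).1
    · filter_upwards [Filter.Ioi_mem_atTop 0] with t ht
      refine (hbd t ht).2.trans_eq (by ring)
  have h := integral_Ioi_of_hasDerivAt_of_tendsto hcont hderiv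
    ((integrableOn_phiKernel_mul hx 0).sub
      ((integrableOn_div_one_sub_exp_neg_mul hx).const_mul x)) hlim
  rw [integral_sub (integrableOn_phiKernel_mul hx 0)
    ((integrableOn_div_one_sub_exp_neg_mul hx).const_mul x), integral_const_mul, hF0] at h
  change laplaceMoment 0 x - _ = _ at h
  rw [eq_div_iff hx.ne']
  linarith

theorem one_add_laplaceMoment_div_sub {x : ℝ} (hx : 0 < x) :
    (1 + laplaceMoment 0 x) / x - (1 + laplaceMoment 0 (x + 1)) / (x + 1) = 1 / x ^ 2 := by
  have hx1 : 0 < x + 1 := by linarith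
  rw [← integral_div_one_sub_exp_neg_mul hx, ← integral_div_one_sub_exp_neg_mul hx1,
    ← integral_sub (integrableOn_div_one_sub_exp_neg_mul hx)
      (integrableOn_div_one_sub_exp_neg_mul hx1)]
  have h := integral_pow_mul_exp_neg hx 1
  simp only [Nat.factorial_one, Nat.cast_one, one_add_one_eq_two] at h
  rw [← h]
  refine setIntegral_congr_fun measurableSet_Ioi fun t ht => ?_
  have hb := one_sub_exp_neg_pos ht
  have he : exp (-((x + 1) * t)) = exp (-(x * t)) * exp (-t) := by
    rw [← exp_add]; ring_nf
  simp only [he]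
  field_simp

end LaplaceMoments

section Trigamma

open Real MeasureTheory Set

/-- The trigamma function, as the second derivative of `log ∘ Gamma`. -/
noncomputable def trigamma (x : ℝ) : ℝ := iteratedDeriv 2 (fun y => log (Gamma y)) x

theorem trigamma_eq_deriv_deriv : trigamma = deriv (deriv fun y => log (Gamma y)) := by
  ext x
  rw [trigamma, iteratedDeriv_succ, iteratedDeriv_one]

theorem contDiffAt_Gamma {x : ℝ} (hx : 0 < x) (n : ℕ) : ContDiffAt ℝ n Gamma x := by
  have hopen : IsOpen {z : ℂ | 0 < z.re} := isOpen_lt continuous_const Complex.continuous_re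
  have hd : DifferentiableOn ℂ Complex.Gamma {z : ℂ | 0 < z.re} := fun z hz =>
    (Complex.differentiableAt_Gamma z fun m hm => by
      have hz : 0 < z.re := hz
      rw [hm] at hz
      simp only [Complex.neg_re, Complex.natCast_re] at hz
      linarith [(Nat.cast_nonneg m : (0 : ℝ) ≤ m)]).differentiableWithinAt
  have hz : (x : ℂ) ∈ {z : ℂ | 0 < z.re} := by simpa using hx
  exact ((hd.contDiffOn hopen).contDiffAt (hopen.mem_nhds hz)).real_of_complex

theorem contDiffOn_log_Gamma (n : ℕ) :
    ContDiffOn ℝ n (fun y => log (Gamma y)) (Ioi 0) := fun _ hx =>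
  ((contDiffAt_Gamma hx n).log (Gamma_pos_of_pos hx).ne').contDiffWithinAt

theorem contDiffOn_deriv_log_Gamma (n : ℕ) :
    ContDiffOn ℝ n (deriv fun y => log (Gamma y)) (Ioi 0) :=
  (contDiffOn_log_Gamma (n + 1)).deriv_of_isOpen isOpen_Ioi (by norm_cast)

theorem hasDerivAt_log_Gamma {x : ℝ} (hx : 0 < x) :
    HasDerivAt (fun y => log (Gamma y)) (deriv (fun y => log (Gamma y)) x) x :=
  (((contDiffOn_log_Gamma 1).differentiableOn (by simp)).differentiableAt
    (Ioi_mem_nhds hx)).hasDerivAt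

theorem hasDerivAt_deriv_log_Gamma {x : ℝ} (hx : 0 < x) :
    HasDerivAt (deriv fun y => log (Gamma y)) (trigamma x) x := by
  rw [trigamma_eq_deriv_deriv]
  exact (((contDiffOn_deriv_log_Gamma 1).differentiableOn (by simp)).differentiableAt
    (Ioi_mem_nhds hx)).hasDerivAt

theorem continuousOn_trigamma : ContinuousOn trigamma (Ioi 0) := by
  rw [trigamma_eq_deriv_deriv]
  exact ((contDiffOn_deriv_log_Gamma 1).deriv_of_isOpen (m := 0) isOpen_Ioi
    (by norm_num)).continuousOn

theorem trigamma_nonneg {x : ℝ} (hx : 0 < x) : 0 ≤ trigamma x := by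
  have hmono : MonotoneOn (deriv fun y => log (Gamma y)) (Ioi 0) :=
    convexOn_log_Gamma.monotoneOn_deriv fun y hy => (hasDerivAt_log_Gamma hy).differentiableAt
  have h := hmono.derivWithin_nonneg (x := x)
  rwa [derivWithin_of_isOpen isOpen_Ioi hx, ← trigamma_eq_deriv_deriv] at h

theorem deriv_log_Gamma_add_one {x : ℝ} (hx : 0 < x) :
    deriv (fun y => log (Gamma y)) (x + 1) = deriv (fun y => log (Gamma y)) x + x⁻¹ := by
  have h1 := (hasDerivAt_log_Gamma (by linarith : 0 < x + 1)).comp_add_const x 1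
  have h2 := (hasDerivAt_log_Gamma hx).add (hasDerivAt_log hx.ne')
  refine h1.unique (h2.congr_of_eventuallyEq ?_)
  filter_upwards [Ioi_mem_nhds hx] with y hy
  have hy : 0 < y := hy
  rw [Gamma_add_one hy.ne', log_mul hy.ne' (Gamma_pos_of_pos hy).ne', add_comm]
  rfl

theorem trigamma_add_one {x : ℝ} (hx : 0 < x) :
    trigamma (x + 1) = trigamma x - 1 / x ^ 2 := by
  have h1 := (hasDerivAt_deriv_log_Gamma (by linarith : 0 < x + 1)).comp_add_const x 1
  have h2 := (hasDerivAt_deriv_log_Gamma hx).add (hasDerivAt_inv hx.ne')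
  have h3 := h1.unique (h2.congr_of_eventuallyEq (by
    filter_upwards [Ioi_mem_nhds hx] with y hy using deriv_log_Gamma_add_one hy))
  rw [h3]
  ring

theorem integral_trigamma {x : ℝ} (hx : 0 < x) : ∫ y in x..x + 1, trigamma y = 1 / x := by
  have hpos : ∀ y ∈ uIcc x (x + 1), 0 < y := fun y hy => by
    rw [uIcc_of_le (by linarith)] at hy
    exact hx.trans_le hy.1
  rw [intervalIntegral.integral_eq_sub_of_hasDerivAt
    (fun y hy => hasDerivAt_deriv_log_Gamma (hpos y hy))
    (continuousOn_trigamma.mono hpos).intervalIntegrable, deriv_log_Gamma_add_one hx]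
  simp

theorem trigamma_eq {x : ℝ} (hx : 0 < x) : trigamma x = (1 + laplaceMoment 0 x) / x := by
  let J : ℝ → ℝ := fun y => (1 + laplaceMoment 0 y) / y
  let P : ℝ → ℝ := fun y => trigamma y - J y
  have hJnn : ∀ y, 0 < y → 0 ≤ J y := fun y hy =>
    div_nonneg (by linarith [laplaceMoment_pos hy 0]) hy.le
  have hPadd : ∀ y, 0 < y → ∀ n : ℕ, P (y + n) = P y := by
    intro y hy n
    induction n with
    | zero => simp
    | succ n ih =>
      have hyn : 0 < y + n := by positivity
      rw [← ih]
      simp only [P, J]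
      push_cast
      rw [← add_assoc, trigamma_add_one hyn]
      linarith [one_add_laplaceMoment_div_sub hyn]
  have hcast : ∀ y : ℝ, Filter.Tendsto (fun n : ℕ => y + n) Filter.atTop Filter.atTop := fun y =>
    Filter.tendsto_atTop_add_const_left _ y tendsto_natCast_atTop_atTop
  have hPnn : ∀ y, 0 < y → 0 ≤ P y := by
    intro y hy
    have hb : ∀ n : ℕ, -((1 + 1 / (y + n)) * (1 / (y + n))) ≤ P y := by
      intro n
      have hyn : 0 < y + n := by positivity
      have h1 : J (y + n) ≤ (1 + 1 / (y + n)) * (1 / (y + n)) := by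
        simp only [J]
        rw [div_eq_mul_one_div]
        gcongr
        exact laplaceMoment_zero_le hyn
      have h2 := trigamma_nonneg hyn
      have h3 := hPadd y hy n
      simp only [P] at h3 ⊢
      linarith
    have hlim : Filter.Tendsto (fun n : ℕ => -((1 + 1 / (y + n)) * (1 / (y + n))))
        Filter.atTop (nhds 0) := by
      have h1 : Filter.Tendsto (fun n : ℕ => 1 / (y + n)) Filter.atTop (nhds 0) := by
        simpa only [one_div] using! (hcast y).inv_tendsto_atTop
      simpa using ((h1.const_add 1).mul h1).neg
    exact le_of_tendsto' hlim hb
  have hPcont : ContinuousOn P (Ioi 0) := continuousOn_trigamma.sub fun y hy =>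
    ((((hasDerivAt_laplaceMoment hy 0).continuousAt).const_add 1).div continuousAt_id
      (ne_of_gt hy)).continuousWithinAt
  have hint : ∀ n : ℕ, ∫ y in x..x + 1, P y ≤ 1 / (x + n) := by
    intro n
    have hxn : 0 < x + n := by positivity
    have hpos : ∀ z : ℝ, 0 < z → ∀ y ∈ uIcc z (z + 1), 0 < y := fun z hz y hy => by
      rw [uIcc_of_le (by linarith)] at hy
      exact hz.trans_le hy.1
    calc ∫ y in x..x + 1, P y = ∫ y in x..x + 1, P (y + n) :=
          intervalIntegral.integral_congr fun y hy => (hPadd y (hpos x hx y hy) n).symm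
      _ = ∫ y in (x + n)..(x + n + 1), P y := by
          rw [intervalIntegral.integral_comp_add_right P]
          congr 1
          ring
      _ ≤ ∫ y in (x + n)..(x + n + 1), trigamma y := by
          refine intervalIntegral.integral_mono_on (by linarith)
            (hPcont.mono (hpos _ hxn)).intervalIntegrable
            (continuousOn_trigamma.mono (hpos _ hxn)).intervalIntegrable fun y hy => ?_
          have := hJnn y (hxn.trans_le hy.1)
          simp only [P]
          linarith
      _ = 1 / (x + n) := integral_trigamma hxn
  have hle : ∫ y in x..x + 1, P y ≤ 0 := by
    refine ge_of_tendsto' (x := Filter.atTop) ?_ hint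
    simpa only [one_div] using! (hcast x).inv_tendsto_atTop
  by_contra hne
  have hPx : 0 < P x := lt_of_le_of_ne (hPnn x hx) fun h => hne (by
    simp only [P, J] at h
    linarith)
  refine hle.not_gt (intervalIntegral.integral_pos (by linarith)
    (hPcont.mono fun y hy => hx.trans_le hy.1) (fun y hy => hPnn y (hx.trans hy.1))
    ⟨x, ⟨le_rfl, by linarith⟩, hPx⟩)

theorem Phi_eq_laplaceMoment {x : ℝ} (hx : 0 < x) : Phi x = laplaceMoment 0 x := by
  have h := trigamma_eq hx
  rw [trigamma, eq_div_iff hx.ne'] at h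
  rw [Phi]
  linarith

theorem iteratedDeriv_Phi (k : ℕ) {x : ℝ} (hx : 0 < x) :
    iteratedDeriv k Phi x = (-1) ^ k * laplaceMoment k x := by
  induction k generalizing x with
  | zero => simpa using Phi_eq_laplaceMoment hx
  | succ k ih =>
    rw [iteratedDeriv_succ]
    refine HasDerivAt.deriv ?_
    refine (((hasDerivAt_laplaceMoment hx k).const_mul ((-1) ^ k)).congr_of_eventuallyEq
      ?_).congr_deriv (by ring)
    filter_upwards [Ioi_mem_nhds hx] with y hy using ih hy

end Trigamma

section CompleteMonotonicity

open Set

/-- The cone of functions spanned by the differences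
`c * (2 (m+n+1)! / (m! n!)) * F m * F n - F (m+n+1)`, where `F = laplaceMoment`. -/
inductive MomentCone (c : ℝ) : (ℝ → ℝ) → Prop
  | base (m n : ℕ) : MomentCone c fun x =>
      c * (2 * (m + n + 1).factorial / (m.factorial * n.factorial)) *
        (laplaceMoment m x * laplaceMoment n x) - laplaceMoment (m + n + 1) x
  | comb {a b : ℝ} {f g : ℝ → ℝ} (ha : 0 ≤ a) (hb : 0 ≤ b) (hf : MomentCone c f)
      (hg : MomentCone c g) : MomentCone c fun x => a * f x + b * g x

namespace MomentCone

variable {c : ℝ} {f : ℝ → ℝ}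

theorem nonneg (hc : 1 ≤ c) (hf : MomentCone c f) {x : ℝ} (hx : 0 < x) : 0 ≤ f x := by
  induction hf with
  | base m n =>
    have h1 := laplaceMoment_add_add_one_le hx m n
    have h2 : (0 : ℝ) ≤ 2 * (m + n + 1).factorial / (m.factorial * n.factorial) *
        (laplaceMoment m x * laplaceMoment n x) :=
      mul_nonneg (by positivity)
        (mul_nonneg (laplaceMoment_pos hx m).le (laplaceMoment_pos hx n).le)
    linarith [le_mul_of_one_le_left h2 hc]
  | comb ha hb _ _ ihf ihg => exact add_nonneg (mul_nonneg ha ihf) (mul_nonneg hb ihg)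

theorem exists_hasDerivAt_neg (hf : MomentCone c f) :
    ∃ g, MomentCone c g ∧ ∀ x, 0 < x → HasDerivAt f (-g x) x := by
  induction hf with
  | base m n =>
    refine ⟨_, comb (a := (m + 1) / (m + n + 2)) (b := (n + 1) / (m + n + 2))
      (by positivity) (by positivity) (base (m + 1) n) (base m (n + 1)), fun x hx => ?_⟩
    refine ((((hasDerivAt_laplaceMoment hx m).mul (hasDerivAt_laplaceMoment hx n)).const_mul
      _).sub (hasDerivAt_laplaceMoment hx (m + n + 1))).congr_deriv ?_
    have h1 : m + 1 + n + 1 = m + n + 1 + 1 := by ring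
    have h2 : m + (n + 1) + 1 = m + n + 1 + 1 := by ring
    rw [h1, h2, Nat.factorial_succ (m + n + 1), Nat.factorial_succ m, Nat.factorial_succ n]
    push_cast
    have h3 : (m + n + 1 + 1 : ℝ) = m + n + 2 := by ring
    rw [h3]
    field_simp
    ring
  | comb ha hb _ _ ihf ihg =>
    obtain ⟨f', hf', hdf⟩ := ihf
    obtain ⟨g', hg', hdg⟩ := ihg
    refine ⟨_, comb ha hb hf' hg', fun x hx => ?_⟩
    refine (((hdf x hx).const_mul _).add ((hdg x hx).const_mul _)).congr_deriv ?_
    ring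

theorem exists_iteratedDeriv_eq (hf : MomentCone c f) (k : ℕ) :
    ∃ g, MomentCone c g ∧ ∀ x, 0 < x → iteratedDeriv k f x = (-1) ^ k * g x := by
  induction k with
  | zero => exact ⟨f, hf, by simp⟩
  | succ k ih =>
    obtain ⟨g, hg, hgx⟩ := ih
    obtain ⟨g', hg', hd⟩ := hg.exists_hasDerivAt_neg
    refine ⟨g', hg', fun x hx => ?_⟩
    rw [iteratedDeriv_succ]
    refine HasDerivAt.deriv ((((hd x hx).const_mul ((-1) ^ k)).congr_of_eventuallyEq
      ?_).congr_deriv (by ring))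
    filter_upwards [Ioi_mem_nhds hx] with y hy using hgx y hy

theorem completelyMonotonicOn (hc : 1 ≤ c) (hf : MomentCone c f) :
    CompletelyMonotonicOn f (Ioi 0) := by
  refine ⟨fun k x hx => ?_, fun k x hx => ?_⟩
  · obtain ⟨g, hg, hgx⟩ := hf.exists_iteratedDeriv_eq k
    obtain ⟨g', -, hd⟩ := hg.exists_hasDerivAt_neg
    refine ((hd x hx).const_mul ((-1) ^ k)).differentiableAt.congr_of_eventuallyEq ?_
    filter_upwards [Ioi_mem_nhds hx] with y hy using hgx y hy
  · obtain ⟨g, hg, hgx⟩ := hf.exists_iteratedDeriv_eq k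
    rw [hgx x hx, ← mul_assoc, ← mul_pow, neg_one_mul, neg_neg, one_pow, one_mul]
    exact hg.nonneg hc hx

end MomentCone

theorem CompletelyMonotonicOn.congr {f g : ℝ → ℝ} {s : Set ℝ} (hs : IsOpen s)
    (hf : CompletelyMonotonicOn f s) (hfg : EqOn g f s) : CompletelyMonotonicOn g s := by
  have h : ∀ n, EqOn (iteratedDeriv n g) (iteratedDeriv n f) s := hfg.iteratedDeriv_of_isOpen hs
  refine ⟨fun n x hx => ?_, fun n x hx => ?_⟩
  · exact (hf.1 n x hx).congr_of_eventuallyEq ((h n).eventuallyEq_of_mem (hs.mem_nhds hx))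
  · rw [h n hx]
    exact hf.2 n x hx

theorem le_of_forall_laplaceMoment_le (m n : ℕ) {ω : ℝ}
    (h : ∀ x, 0 < x → laplaceMoment (m + n + 1) x ≤
      ω * (laplaceMoment m x * laplaceMoment n x)) :
    2 * (Nat.factorial (m + n + 1) : ℝ) / (Nat.factorial m * Nat.factorial n) ≤ ω := by
  have hω : 0 < ω := pos_of_mul_pos_left ((laplaceMoment_pos one_pos _).trans_le (h 1 one_pos))
    (mul_pos (laplaceMoment_pos one_pos m) (laplaceMoment_pos one_pos n)).le
  have hb : ∀ x : ℝ, 0 < x →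
      2 * (Nat.factorial (m + n + 1) : ℝ) / (Nat.factorial m * Nat.factorial n) ≤
        ω * ((1 + (m + 1) / x) * (1 + (n + 1) / x)) := by
    intro x hx
    have h1 := (le_laplaceMoment hx (m + n + 1)).trans ((h x hx).trans
      (mul_le_mul_of_nonneg_left (mul_le_mul (laplaceMoment_le hx m) (laplaceMoment_le hx n)
        (laplaceMoment_pos hx n).le (by positivity)) hω.le))
    have h2 : (0 : ℝ) < 4 * x ^ (m + n + 2) / (m.factorial * n.factorial) := by positivity
    have h3 := mul_le_mul_of_nonneg_left h1 h2.le
    have e1 : 4 * x ^ (m + n + 2) / (m.factorial * n.factorial) *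
        ((m + n + 1).factorial / (2 * x ^ (m + n + 1 + 1))) =
        2 * (Nat.factorial (m + n + 1) : ℝ) / (Nat.factorial m * Nat.factorial n) := by
      field_simp
      norm_num
    have e2 : 4 * x ^ (m + n + 2) / (m.factorial * n.factorial) *
        (ω * (m.factorial / (2 * x ^ (m + 1)) * (1 + (m + 1) / x) *
          (n.factorial / (2 * x ^ (n + 1)) * (1 + (n + 1) / x)))) =
        ω * ((1 + (m + 1) / x) * (1 + (n + 1) / x)) := by
      have : x ^ (m + n + 2) = x ^ (m + 1) * x ^ (n + 1) := by ring
      rw [this]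
      generalize (1 + (m + 1) / x) = A
      generalize (1 + (n + 1) / x) = B
      field_simp
      norm_num
    rwa [e1, e2] at h3
  have hlim : Filter.Tendsto (fun x : ℝ => ω * ((1 + (m + 1) / x) * (1 + (n + 1) / x)))
      Filter.atTop (nhds (ω * ((1 + 0) * (1 + 0)))) :=
    (((Filter.tendsto_id.const_div_atTop _).const_add 1).mul
      ((Filter.tendsto_id.const_div_atTop _).const_add 1)).const_mul ω
  simp only [add_zero, mul_one] at hlim
  refine ge_of_tendsto hlim ?_
  filter_upwards [Filter.Ioi_mem_atTop 0] with x hx using hb x hx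

end CompleteMonotonicity

theorem calY_pos_completelyMonotonic_iff (m n : ℕ) (ω : ℝ) :
    CompletelyMonotonicOn
      (fun x => (-1:ℝ) ^ (m + n) *
        (iteratedDeriv (m + n + 1) Phi x + ω * iteratedDeriv m Phi x * iteratedDeriv n Phi x))
      (Set.Ioi 0) ↔
    2 * (Nat.factorial (m + n + 1) : ℝ) / (Nat.factorial m * Nat.factorial n) ≤ ω := by
  have heq : ∀ x : ℝ, 0 < x → (-1:ℝ) ^ (m + n) *
      (iteratedDeriv (m + n + 1) Phi x + ω * iteratedDeriv m Phi x * iteratedDeriv n Phi x) =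
      ω * (laplaceMoment m x * laplaceMoment n x) - laplaceMoment (m + n + 1) x := by
    intro x hx
    rw [iteratedDeriv_Phi _ hx, iteratedDeriv_Phi _ hx, iteratedDeriv_Phi _ hx]
    have h : (-1 : ℝ) ^ (m + n) * (-1) ^ (m + n) = 1 := by
      rw [← mul_pow, neg_one_mul, neg_neg, one_pow]
    rw [pow_succ]
    linear_combination (ω * (laplaceMoment m x * laplaceMoment n x) -
      laplaceMoment (m + n + 1) x) * h
  constructor
  · intro hcm
    refine le_of_forall_laplaceMoment_le m n fun x hx => ?_
    have h := hcm.2 0 x hx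
    rw [iteratedDeriv_zero, pow_zero, one_mul, heq x hx] at h
    linarith
  · intro hω
    set C : ℝ := 2 * (Nat.factorial (m + n + 1) : ℝ) / (Nat.factorial m * Nat.factorial n) with hC
    have hCpos : 0 < C := by positivity
    refine ((MomentCone.base (c := ω / C) m n).completelyMonotonicOn
      ((one_le_div hCpos).2 hω)).congr isOpen_Ioi fun x hx => ?_
    simp only [heq x hx, ← hC, div_mul_cancel₀ _ hCpos.ne']
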